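/- arXiv:1109.2328 — 2 statements merged into one kernel-verified Lean document; each statement's English description precedes it below -/
import Mathlib

section
/- Let S_{2π} = {z ∈ ℂ : 0 < Im z < 2π}, and let I_π be the reflection about the line {Im z = π}, i.e. I_π(z) = conj(z) + 2πi. Fix w₀ ∈ ℂ with Im w₀ = π and an open connected set Σ with w₀ ∈ Σ ⊆ S_{2π} and I_π(Σ) = Σ. For each n ∈ ℕ, let D_n be a simply connected domain with Σ ⊆ D_n ⊆ S_{2π} and I_π(D_n) = D_n, and let f_n : S_{2π} → D_n be a holomorphic bijection with f_n(w₀) = w₀, with f_n'(w₀) a positive real number, and with f_n ∘ I_π = I_π ∘ f_n. Then there exist a subsequence (f_{n_k}), a simply connected domain D₀ with Σ ⊆ D₀ ⊆ S_{2π} and I_π(D₀) = D₀, and a holomorphic bijection f : S_{2π} → D₀ with f(w₀) = w₀, f'(w₀) > 0 and f ∘ I_π = I_π ∘ f, such that f_{n_k} → f locally uniformly on S_{2π}. -/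
open Complex Filter Set

/-- The reflection about the line `{Im z = π}`: `I_π(z) = conj(z) + 2πi`. -/
noncomputable def reflPi (z : ℂ) : ℂ := (starRingEnd ℂ) z + 2 * Real.pi * Complex.I


/-- Montel's theorem for families bounded by one. -/
theorem aux_montel {U : Set ℂ} (hU : IsOpen U) (F : ℕ → ℂ → ℂ)
    (hd : ∀ n, DifferentiableOn ℂ (F n) U) (hb : ∀ n, ∀ z ∈ U, ‖F n z‖ ≤ 1) :
    ∃ φ : ℕ → ℕ, StrictMono φ ∧ ∃ G : ℂ → ℂ,
      TendstoLocallyUniformlyOn (fun k => F (φ k)) G atTop U := by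
  classical
  let P : (U → ℂ) → Prop := fun f => (∀ x, ‖f x‖ ≤ 1) ∧ ∀ (x : U) (r : ℝ), 0 < r →
    Metric.ball (x : ℂ) r ⊆ U → ∀ y : U, dist (y : ℂ) x < r → dist (f y) (f x) ≤ 2 / r * dist (y : ℂ) x
  have hball : ∀ x : U, ∃ r > 0, Metric.ball (x : ℂ) r ⊆ U := fun x =>
    Metric.isOpen_iff.1 hU x x.2
  have hPcont : ∀ f, P f → Continuous f := by
    intro f hf
    rw [Metric.continuous_iff]
    intro x ε hε
    obtain ⟨r, hr, hrU⟩ := hball x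
    refine ⟨min r (ε * r / 2), by positivity, fun y hy => ?_⟩
    have h1 : dist (y : ℂ) x < min r (ε * r / 2) := hy
    have h2 := hf.2 x r hr hrU y (lt_of_lt_of_le h1 (min_le_left _ _))
    refine h2.trans_lt ?_
    have h3 := lt_of_lt_of_le h1 (min_le_right _ _)
    calc 2 / r * dist (y : ℂ) x < 2 / r * (ε * r / 2) := by gcongr
      _ = ε := by field_simp
  let S : Set C(U, ℂ) := {f | P f}
  have himg : ContinuousMap.toFun '' S = {f | P f} := by
    ext f
    constructor
    · rintro ⟨g, hg, rfl⟩; exact hg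
    · intro hf; exact ⟨⟨f, hPcont f hf⟩, hf, rfl⟩
  have hcl : IsClosed {f : U → ℂ | P f} := by
    simp only [P, Set.ofPred_and, Set.ofPred_forall]
    refine IsClosed.inter ?_ ?_
    · exact isClosed_iInter fun x => isClosed_le (by fun_prop) (by fun_prop)
    · refine isClosed_iInter fun x => isClosed_iInter fun r => isClosed_iInter fun _ =>
        isClosed_iInter fun _ => isClosed_iInter fun y => isClosed_iInter fun _ =>
        isClosed_le (by fun_prop) (by fun_prop)
  have hcomp : IsCompact {f : U → ℂ | P f} := by
    refine IsCompact.of_isClosed_subset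
      (isCompact_univ_pi (fun _ : U => isCompact_closedBall (0 : ℂ) 1)) hcl ?_
    intro f hf x _
    simpa using hf.1 x
  have heq : Equicontinuous ((↑) : S → U → ℂ) := by
    intro x
    rw [Metric.equicontinuousAt_iff]
    intro ε hε
    obtain ⟨r, hr, hrU⟩ := hball x
    refine ⟨min r (ε * r / 2), by positivity, fun y hy f => ?_⟩
    have h1 : dist (y : ℂ) x < min r (ε * r / 2) := hy
    have h2 := f.2.2 x r hr hrU y (lt_of_lt_of_le h1 (min_le_left _ _))
    rw [dist_comm]
    refine h2.trans_lt ?_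
    have h3 := lt_of_lt_of_le h1 (min_le_right _ _)
    calc 2 / r * dist (y : ℂ) x < 2 / r * (ε * r / 2) := by gcongr
      _ = ε := by field_simp
  have hS : IsCompact S := ArzelaAscoli.isCompact_of_equicontinuous S (himg ▸ hcomp) heq
  have : LocallyCompactSpace U := hU.locallyCompactSpace
  let Fc : ℕ → C(U, ℂ) := fun n => ⟨fun x => F n x, (hd n).continuousOn.domRestrict⟩
  have hFc : ∀ n, Fc n ∈ S := by
    intro n
    refine ⟨fun x => hb n x x.2, fun x r hr hrU y hy => ?_⟩
    refine Complex.dist_le_div_mul_dist_of_mapsTo_ball ((hd n).mono hrU) ?_ hy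
    intro z hz
    have h1 := hb n z (hrU hz)
    have h2 := hb n x x.2
    rw [mem_closedBall_iff_norm]
    exact (norm_sub_le _ _).trans (by linarith)
  obtain ⟨G, -, φ, hφ, hG⟩ := hS.tendsto_subseq hFc
  refine ⟨φ, hφ, fun z => if h : z ∈ U then G ⟨z, h⟩ else 0, ?_⟩
  rw [tendstoLocallyUniformlyOn_iff_tendstoLocallyUniformly_comp_coe]
  rw [ContinuousMap.tendsto_iff_tendstoLocallyUniformly] at hG
  have hGe : (fun z => if h : z ∈ U then G ⟨z, h⟩ else 0) ∘ ((↑) : U → ℂ) = G := by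
    funext x
    simp
  rw [hGe]
  exact hG

theorem aux_open {S : Set ℂ} (hS : IsOpen S) {f : ℂ → ℂ} (hd : DifferentiableOn ℂ f S)
    (hi : InjOn f S) {a : ℂ} (ha : a ∈ S) : nhds (f a) ≤ map f (nhds a) := by
  have han : AnalyticAt ℂ f a := hd.analyticAt (hS.mem_nhds ha)
  refine han.eventually_constant_or_nhds_le_map_nhds.resolve_left fun h => ?_
  have h1 : ∀ᶠ z in nhds a, z = a := by
    filter_upwards [h, hS.mem_nhds ha] with z hz hzS using hi hzS ha hz
  have h2 : ∃ᶠ z in nhds a, z ≠ a := by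
    have := (inferInstance : (nhdsWithin a {a}ᶜ).NeBot)
    exact (eventually_mem_nhdsWithin (a := a) (s := {a}ᶜ)).frequently.filter_mono nhdsWithin_le_nhds
  exact h2 (h1.mono fun z hz hne => hne hz)

theorem aux_inv {S : Set ℂ} (hS : IsOpen S) {f h : ℂ → ℂ} (hd : DifferentiableOn ℂ f S)
    (hh : ∀ z ∈ S, h (f z) = z) : ∀ a ∈ S, DifferentiableAt ℂ h (f a) := by
  have hi : InjOn f S := fun x hx y hy hxy => by rw [← hh x hx, ← hh y hy, hxy]
  have hc : ∀ a ∈ S, ContinuousAt h (f a) := by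
    intro a ha
    have h1 : Tendsto h (map f (nhds a)) (nhds a) := by
      rw [tendsto_map'_iff]
      refine tendsto_id.congr' ?_
      filter_upwards [hS.mem_nhds ha] with z hz using (hh z hz).symm
    have := h1.mono_left (aux_open hS hd hi ha)
    rwa [ContinuousAt, hh a ha]
  have hgood : ∀ a ∈ S, deriv f a ≠ 0 → DifferentiableAt ℂ h (f a) := by
    intro a ha hda
    have h1 : HasDerivAt f (deriv f a) (h (f a)) := by
      rw [hh a ha]; exact (hd.differentiableAt (hS.mem_nhds ha)).hasDerivAt
    refine (HasDerivAt.of_local_left_inverse (hc a ha) h1 hda ?_).differentiableAt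
    refine aux_open hS hd hi ha ?_
    change ∀ᶠ z in nhds a, f (h (f z)) = f z
    filter_upwards [hS.mem_nhds ha] with z hz
    rw [hh z hz]
  intro a ha
  have hda : AnalyticAt ℂ (deriv f) a := (hd.analyticAt (hS.mem_nhds ha)).deriv
  rcases hda.eventually_eq_zero_or_eventually_ne_zero with h0 | h0
  · exfalso
    obtain ⟨r, hr, hrb⟩ := Metric.eventually_nhds_iff_ball.1 (h0.and (hS.mem_nhds ha))
    have hcst : ∀ z ∈ Metric.ball a r, f z = f a := by
      intro z hz
      refine (Metric.isOpen_ball).is_const_of_deriv_eq_zero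
        (convex_ball a r).isPreconnected (hd.mono fun z hz => (hrb z hz).2) (fun z hz => (hrb z hz).1) hz (Metric.mem_ball_self hr)
    have hz : a + (r/2 : ℝ) ∈ Metric.ball a r := by
      simp [abs_of_pos hr]; linarith
    have := hi (hrb _ hz).2 ha (hcst _ hz)
    simp at this; linarith
  · rw [eventually_nhdsWithin_iff] at h0
    have hV : f '' {z | z ∈ S ∧ (z ≠ a → deriv f z ≠ 0)} ∈ nhds (f a) := by
      refine aux_open hS hd hi ha ?_
      refine mem_map.2 ?_
      filter_upwards [h0, hS.mem_nhds ha] with z hz hzS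
      exact ⟨z, ⟨hzS, hz⟩, rfl⟩
    refine DifferentiableOn.differentiableAt
      ((Complex.differentiableOn_compl_singleton_and_continuousAt_iff hV).1 ⟨?_, hc a ha⟩) hV
    rintro _ ⟨⟨z, ⟨hzS, hz⟩, rfl⟩, hne⟩
    refine (hgood z hzS (hz ?_)).differentiableWithinAt
    rintro rfl; exact hne rfl

/-- Hurwitz: limits of injective maps take each value at most once. -/
theorem aux_hurwitz_loc {S : Set ℂ} (hS : IsOpen S) (hSc : IsPreconnected S)
    {F : ℕ → ℂ → ℂ} {g : ℂ → ℂ} (hd : ∀ n, DifferentiableOn ℂ (F n) S)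
    (hinj : ∀ n, InjOn (F n) S)
    (hlim : TendstoLocallyUniformlyOn F g atTop S) (hnc : ∃ x ∈ S, ∃ y ∈ S, g x ≠ g y)
    {a : ℂ} (ha : a ∈ S) {R : ℝ} (hR : 0 < R) :
    ∀ᶠ n in atTop, ∃ z ∈ S, dist z a < R ∧ F n z = g a := by
  have hg : DifferentiableOn ℂ g S := hlim.differentiableOn (.of_forall hd) hS
  have hga : AnalyticOnNhd ℂ g S := hg.analyticOnNhd hS
  rcases (hga a ha).eventually_eq_or_eventually_ne (analyticAt_const (v := g a)) with h | h
  · exfalso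
    obtain ⟨x, hx, y, hy, hxy⟩ := hnc
    have := hga.eqOn_of_preconnected_of_eventuallyEq analyticOnNhd_const hSc ha h
    exact hxy ((this hx).trans (this hy).symm)
  rw [eventually_nhdsWithin_iff] at h
  obtain ⟨r₀, hr₀, hb⟩ := Metric.eventually_nhds_iff_ball.1 (h.and (hS.mem_nhds ha))
  obtain ⟨r, hr, hrlt⟩ : ∃ r, 0 < r ∧ r < min r₀ R := exists_between (lt_min hr₀ hR)
  have hrr₀ : r < r₀ := hrlt.trans_le (min_le_left _ _)
  have hrR : r < R := hrlt.trans_le (min_le_right _ _)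
  have hcb : Metric.closedBall a r ⊆ S := fun z hz =>
    (hb z (Metric.closedBall_subset_ball hrr₀ hz)).2
  obtain ⟨m, hm, hmin⟩ : ∃ m ∈ Metric.sphere a r, ∀ z ∈ Metric.sphere a r, ‖g m - g a‖ ≤ ‖g z - g a‖ := by
    have hc : ContinuousOn (fun z => ‖g z - g a‖) (Metric.sphere a r) :=
      ((hg.continuousOn.mono (Metric.sphere_subset_closedBall.trans hcb)).sub continuousOn_const).norm
    obtain ⟨m, hm, h'⟩ := (isCompact_sphere a r).exists_isMinOn
      (NormedSpace.sphere_nonempty.2 hr.le) hc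
    exact ⟨m, hm, fun z hz => h' hz⟩
  have hpos : 0 < ‖g m - g a‖ := by
    rw [norm_pos_iff, sub_ne_zero]
    refine (hb m (Metric.closedBall_subset_ball hrr₀ (Metric.sphere_subset_closedBall hm))).1 ?_
    rintro rfl
    simp at hm; linarith
  set ε := ‖g m - g a‖ / 4 with hε
  have hε0 : 0 < ε := by positivity
  have hu : TendstoUniformlyOn F g atTop (Metric.closedBall a r) :=
    (tendstoLocallyUniformlyOn_iff_forall_isCompact hS).1 hlim _ hcb (isCompact_closedBall a r)
  filter_upwards [Metric.tendstoUniformlyOn_iff.1 hu ε hε0] with n hn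
  have hna := hn a (Metric.mem_closedBall_self hr.le)
  have hdc : DiffContOnCl ℂ (F n) (Metric.ball a r) := by
    refine DifferentiableOn.diffContOnCl ?_
    rw [closure_ball a hr.ne']
    exact (hd n).mono hcb
  have key := hdc.ball_subset_image_closedBall (ε := 2 * ε) hr ?_ ?_
  · have hmem : g a ∈ Metric.ball (F n a) (2 * ε / 2) := by
      rw [Metric.mem_ball]; linarith
    obtain ⟨z, hz, hz'⟩ := key hmem
    exact ⟨z, hcb hz, lt_of_le_of_lt hz hrR, hz'⟩
  · intro z hz
    have h1 := hn z (Metric.sphere_subset_closedBall hz)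
    have h2 := hmin z hz
    rw [← dist_eq_norm, ← dist_eq_norm] at h2
    rw [← dist_eq_norm]
    rw [← dist_eq_norm] at hε
    have h3 := dist_triangle4 (g z) (F n z) (F n a) (g a)
    rw [dist_comm (F n a)] at h3
    linarith
  · have : (nhdsWithin a {a}ᶜ).NeBot := inferInstance
    refine Frequently.filter_mono (Eventually.frequently ?_) (nhdsWithin_le_nhds (s := {a}ᶜ))
    filter_upwards [nhdsWithin_le_nhds (hS.mem_nhds ha), self_mem_nhdsWithin] with z hz hza h
    exact hza (hinj n hz ha h)

theorem aux_hurwitz {S : Set ℂ} (hS : IsOpen S) (hSc : IsPreconnected S)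
    {F : ℕ → ℂ → ℂ} {g : ℂ → ℂ} (hd : ∀ n, DifferentiableOn ℂ (F n) S)
    (hinj : ∀ n, InjOn (F n) S)
    (hlim : TendstoLocallyUniformlyOn F g atTop S) (hnc : ∃ x ∈ S, ∃ y ∈ S, g x ≠ g y) :
    InjOn g S := by
  intro a ha b hb hab
  by_contra hne
  have hR : 0 < dist a b / 2 := by have := dist_pos.2 hne; positivity
  obtain ⟨n, ⟨x, hx, hxa, hx'⟩, ⟨y, hy, hyb, hy'⟩⟩ :=
    ((aux_hurwitz_loc hS hSc hd hinj hlim hnc ha hR).and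
      (aux_hurwitz_loc hS hSc hd hinj hlim hnc hb hR)).exists
  have : x = y := hinj n hx hy (by rw [hx', hy', hab])
  subst this
  have := dist_triangle_left a b x
  linarith

/-- Strict maximum principle. -/
theorem aux_max {U : Set ℂ} (hU : IsOpen U) (hUc : IsPreconnected U) {G : ℂ → ℂ}
    (hd : DifferentiableOn ℂ G U) (hb : ∀ z ∈ U, ‖G z‖ ≤ 1) {w : ℂ} (hw : w ∈ U) (hGw : G w = 0) :
    ∀ z ∈ U, ‖G z‖ < 1 := by
  intro z hz
  refine lt_of_le_of_ne (hb z hz) fun h => ?_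
  have := Complex.norm_eqOn_of_isPreconnected_of_isMaxOn hUc hU hd hz (fun x hx => by
    simpa [h] using hb x hx) hw
  simp [hGw, h] at this

theorem aux_comp {S T : Set ℂ} {F : ℕ → ℂ → ℂ} {G ψ : ℂ → ℂ}
    (hT : IsOpen T) (hψ : ContinuousOn ψ T) (hG : ContinuousOn G S) (hGT : ∀ z ∈ S, G z ∈ T)
    (hlim : TendstoLocallyUniformlyOn F G atTop S) :
    TendstoLocallyUniformlyOn (fun n z => ψ (F n z)) (fun z => ψ (G z)) atTop S := by
  rw [Metric.tendstoLocallyUniformlyOn_iff] at hlim ⊢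
  intro ε hε x hx
  have hc := Metric.continuousAt_iff.1 (hψ.continuousAt (hT.mem_nhds (hGT x hx))) (ε / 2) (by positivity)
  obtain ⟨δ, hδ, hδ'⟩ := hc
  obtain ⟨t, ht, hn⟩ := hlim (δ / 2) (by positivity) x hx
  have hG' := Metric.continuousWithinAt_iff'.1 (hG x hx) (δ / 2) (by positivity)
  refine ⟨t ∩ {y | dist (G y) (G x) < δ / 2}, inter_mem ht hG', ?_⟩
  filter_upwards [hn] with n hn y hy
  have h1 := hn y hy.1
  have h2 : dist (G y) (G x) < δ / 2 := hy.2
  have h3 : dist (F n y) (G x) < δ := by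
    have := dist_triangle_left (F n y) (G x) (G y)
    linarith
  have h4 := hδ' h3
  have h5 := hδ' (show dist (G y) (G x) < δ by linarith)
  have := dist_triangle_right (ψ (G y)) (ψ (F n y)) (ψ (G x))
  linarith

/-- Conformal map from the strip to the disc sending `w` to `0`. -/
noncomputable def auxTau (w z : ℂ) : ℂ := (exp ((z - w) / 2) - 1) / (exp ((z - w) / 2) + 1)

/-- Inverse of `auxTau w`. -/
noncomputable def auxPsi (w u : ℂ) : ℂ := w + 2 * log ((1 + u) / (1 - u))

theorem auxTau_self (w : ℂ) : auxTau w w = 0 := by simp [auxTau]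

theorem auxPsi_zero (w : ℂ) : auxPsi w 0 = w := by simp [auxPsi]

theorem aux_re_pos {w z : ℂ} (hw : w.im = Real.pi) (hz : 0 < z.im ∧ z.im < 2 * Real.pi) :
    0 < (exp ((z - w) / 2)).re := by
  rw [exp_re]
  have h : ((z - w) / 2).im = (z.im - Real.pi) / 2 := by simp [hw]
  rw [h]
  refine mul_pos (Real.exp_pos _) (Real.cos_pos_of_mem_Ioo ⟨?_, ?_⟩) <;> linarith

theorem aux_ne {e : ℂ} (he : 0 < e.re) : e + 1 ≠ 0 := by
  intro h
  have := congrArg re h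
  simp at this; linarith

theorem auxTau_lt {w z : ℂ} (hw : w.im = Real.pi) (hz : 0 < z.im ∧ z.im < 2 * Real.pi) :
    ‖auxTau w z‖ < 1 := by
  have he := aux_re_pos hw hz
  have hne := aux_ne he
  rw [auxTau, norm_div, div_lt_one (norm_pos_iff.2 hne)]
  generalize exp ((z - w) / 2) = e at *
  rw [← sq_lt_sq₀ (norm_nonneg _) (norm_nonneg _), ← normSq_eq_norm_sq, ← normSq_eq_norm_sq,
    normSq_apply, normSq_apply]
  simp
  nlinarith

theorem auxPsi_tau {w z : ℂ} (hw : w.im = Real.pi) (hz : 0 < z.im ∧ z.im < 2 * Real.pi) :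
    auxPsi w (auxTau w z) = z := by
  have he := aux_re_pos hw hz
  have hne := aux_ne he
  have h : (1 + auxTau w z) / (1 - auxTau w z) = exp ((z - w) / 2) := by
    rw [auxTau]
    generalize exp ((z - w) / 2) = e at *
    have h1 : 1 + (e - 1) / (e + 1) = 2 * e / (e + 1) := by field_simp; ring
    have h2 : 1 - (e - 1) / (e + 1) = 2 / (e + 1) := by field_simp; ring
    rw [h1, h2]
    field_simp
  have hi : ((z - w) / 2).im = (z.im - Real.pi) / 2 := by simp [hw]
  rw [auxPsi, h, log_exp (by rw [hi]; linarith [Real.pi_pos]) (by rw [hi]; linarith [Real.pi_pos])]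
  ring

theorem auxTau_diff {w : ℂ} (hw : w.im = Real.pi) :
    DifferentiableOn ℂ (auxTau w) {z : ℂ | 0 < z.im ∧ z.im < 2 * Real.pi} := by
  intro z hz
  refine DifferentiableAt.differentiableWithinAt ?_
  unfold auxTau
  exact DifferentiableAt.div (by fun_prop) (by fun_prop) (aux_ne (aux_re_pos hw hz))

theorem aux_moeb {u : ℂ} (hu : ‖u‖ < 1) : 0 < ((1 + u) / (1 - u)).re ∧ 1 - u ≠ 0 := by
  have hne : 1 - u ≠ 0 := by
    intro h
    have : u = 1 := by linear_combination -h
    simp [this] at hu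
  refine ⟨?_, hne⟩
  have h1 : 0 < normSq (1 - u) := normSq_pos.2 hne
  have h2 : normSq u < 1 := by
    rw [normSq_eq_norm_sq]; nlinarith [norm_nonneg u]
  rw [normSq_apply] at h2
  rw [div_re, ← add_div]
  refine div_pos ?_ h1
  simp
  nlinarith

theorem auxPsi_diff (w : ℂ) : DifferentiableOn ℂ (auxPsi w) (Metric.ball 0 1) := by
  intro u hu
  obtain ⟨h1, h2⟩ := aux_moeb (mem_ball_zero_iff.1 hu)
  refine DifferentiableAt.differentiableWithinAt ?_
  unfold auxPsi
  have h3 : DifferentiableAt ℂ (fun u : ℂ => (1 + u) / (1 - u)) u :=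
    DifferentiableAt.div (by fun_prop) (by fun_prop) h2
  have h4 : DifferentiableAt ℂ (fun u : ℂ => log ((1 + u) / (1 - u))) u := h3.clog (Or.inl h1)
  exact (h4.const_mul 2).const_add w

theorem auxPsi_mem {w u : ℂ} (hw : w.im = Real.pi) (hu : ‖u‖ < 1) :
    0 < (auxPsi w u).im ∧ (auxPsi w u).im < 2 * Real.pi := by
  obtain ⟨h1, h2⟩ := aux_moeb hu
  have h3 := abs_lt.1 (abs_arg_lt_pi_div_two_iff.2 (Or.inl h1))
  have h4 : (auxPsi w u).im = Real.pi + 2 * arg ((1 + u) / (1 - u)) := by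
    simp [auxPsi, hw, log_im]
  rw [h4]
  constructor <;> linarith [h3.1, h3.2]

theorem aux_strip_open : IsOpen {z : ℂ | 0 < z.im ∧ z.im < 2 * Real.pi} :=
  (isOpen_lt continuous_const continuous_im).inter (isOpen_lt continuous_im continuous_const)

theorem aux_strip_convex : Convex ℝ {z : ℂ | 0 < z.im ∧ z.im < 2 * Real.pi} :=
  (convex_halfSpace_im_gt 0).inter (convex_halfSpace_im_lt (2 * Real.pi))

theorem aux_refl_mem {z : ℂ} (hz : 0 < z.im ∧ z.im < 2 * Real.pi) :
    0 < (reflPi z).im ∧ (reflPi z).im < 2 * Real.pi := by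
  simp [reflPi]
  exact ⟨hz.2, hz.1⟩

theorem aux_refl_refl (z : ℂ) : reflPi (reflPi z) = z := by
  simp [reflPi, Complex.ext_iff]

theorem aux_refl_cont : Continuous reflPi := by
  unfold reflPi
  exact (continuous_conj).add continuous_const

theorem aux_sub {F : ℕ → ℂ → ℂ} {g : ℂ → ℂ} {S : Set ℂ}
    (h : TendstoLocallyUniformlyOn F g atTop S) {σ : ℕ → ℕ} (hσ : StrictMono σ) :
    TendstoLocallyUniformlyOn (fun k => F (σ k)) g atTop S := fun u hu x hx =>
  let ⟨t, ht, hev⟩ := h u hu x hx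
  ⟨t, ht, hσ.tendsto_atTop.eventually hev⟩

/-- The image of a simply connected open set under an injective holomorphic map. -/
theorem aux_sc {S : Set ℂ} (hS : IsOpen S) (hSc : SimplyConnectedSpace S) {g : ℂ → ℂ}
    (hd : DifferentiableOn ℂ g S) (hi : InjOn g S) :
    IsOpen (g '' S) ∧ SimplyConnectedSpace ↥(g '' S) := by
  have ho : ∀ V ⊆ S, IsOpen V → IsOpen (g '' V) := by
    intro V hV hVo
    rw [isOpen_iff_mem_nhds]
    rintro _ ⟨a, ha, rfl⟩
    exact aux_open hS hd hi (hV ha) (image_mem_map (hVo.mem_nhds ha))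
  refine ⟨ho S Subset.rfl hS, ?_⟩
  let e : S ≃ₜ (g '' S) := Equiv.toHomeomorphOfContinuousOpen (Equiv.Set.imageOfInjOn g S hi)
    (by
      refine Continuous.subtype_mk ?_ _
      exact hd.continuousOn.domRestrict)
    (by
      intro V hV
      rw [isOpen_induced_iff]
      refine ⟨g '' (Subtype.val '' V), ho _ (by rintro _ ⟨x, -, rfl⟩; exact x.2)
        (hS.isOpenMap_subtype_val _ hV), ?_⟩
      ext ⟨y, hy⟩
      constructor
      · rintro ⟨_, ⟨x, hx, rfl⟩, rfl⟩
        exact ⟨x, hx, rfl⟩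
      · rintro ⟨x, hx, hxy⟩
        exact ⟨x, ⟨x, hx, rfl⟩, congrArg Subtype.val hxy⟩)
  exact e.symm.toHomotopyEquiv.simplyConnectedSpace

/-- Normal-family compactness for conformal maps of the strip
`S_{2π} = {0 < Im z < 2π}` onto simply connected domains `D_n` with `Σ ⊆ D_n ⊆ S_{2π}`,
symmetric about `{Im z = π}`, normalized at a fixed point `w₀` with `Im w₀ = π`:
some subsequence converges locally uniformly on `S_{2π}` to a conformal map onto a
simply connected domain `D₀` with the same properties. -/
theorem statement8 (w₀ : ℂ) (hw₀ : w₀.im = Real.pi)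
    (Sig : Set ℂ) (hSigopen : IsOpen Sig) (hSigconn : IsConnected Sig)
    (hwSig : w₀ ∈ Sig) (hSigsub : Sig ⊆ {z : ℂ | 0 < z.im ∧ z.im < 2 * Real.pi})
    (hSigsym : reflPi '' Sig = Sig)
    (D : ℕ → Set ℂ) (f : ℕ → ℂ → ℂ)
    (hDopen : ∀ n, IsOpen (D n)) (hDconn : ∀ n, IsConnected (D n))
    (hDsc : ∀ n, SimplyConnectedSpace ↥(D n))
    (hDsupSig : ∀ n, Sig ⊆ D n)
    (hDsub : ∀ n, D n ⊆ {z : ℂ | 0 < z.im ∧ z.im < 2 * Real.pi})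
    (hDsym : ∀ n, reflPi '' (D n) = D n)
    (hfdiff : ∀ n, DifferentiableOn ℂ (f n) {z : ℂ | 0 < z.im ∧ z.im < 2 * Real.pi})
    (hfbij : ∀ n, Set.BijOn (f n) {z : ℂ | 0 < z.im ∧ z.im < 2 * Real.pi} (D n))
    (hffix : ∀ n, f n w₀ = w₀)
    (hfderiv : ∀ n, (deriv (f n) w₀).im = 0 ∧ 0 < (deriv (f n) w₀).re)
    (hfsym : ∀ n, ∀ z ∈ {z : ℂ | 0 < z.im ∧ z.im < 2 * Real.pi},
      f n (reflPi z) = reflPi (f n z)) :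
    ∃ φ : ℕ → ℕ, StrictMono φ ∧
    ∃ D₀ : Set ℂ, IsOpen D₀ ∧ IsConnected D₀ ∧ SimplyConnectedSpace ↥D₀ ∧
      Sig ⊆ D₀ ∧ D₀ ⊆ {z : ℂ | 0 < z.im ∧ z.im < 2 * Real.pi} ∧ reflPi '' D₀ = D₀ ∧
    ∃ g : ℂ → ℂ,
      DifferentiableOn ℂ g {z : ℂ | 0 < z.im ∧ z.im < 2 * Real.pi} ∧
      Set.BijOn g {z : ℂ | 0 < z.im ∧ z.im < 2 * Real.pi} D₀ ∧
      g w₀ = w₀ ∧ (deriv g w₀).im = 0 ∧ 0 < (deriv g w₀).re ∧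
      (∀ z ∈ {z : ℂ | 0 < z.im ∧ z.im < 2 * Real.pi}, g (reflPi z) = reflPi (g z)) ∧
      TendstoLocallyUniformlyOn (fun k => f (φ k)) g Filter.atTop
        {z : ℂ | 0 < z.im ∧ z.im < 2 * Real.pi} := by
  classical
  set S : Set ℂ := {z : ℂ | 0 < z.im ∧ z.im < 2 * Real.pi} with hSdef
  have hSo : IsOpen S := aux_strip_open
  have hScv : Convex ℝ S := aux_strip_convex
  have hw₀S : w₀ ∈ S := hSigsub hwSig
  have hScon : IsConnected S := ⟨⟨w₀, hw₀S⟩, hScv.isPreconnected⟩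
  have hSsc : SimplyConnectedSpace S := by
    have := hScv.contractibleSpace ⟨w₀, hw₀S⟩
    infer_instance
  have hfS : ∀ n, ∀ z ∈ S, f n z ∈ S := fun n z hz => hDsub n ((hfbij n).mapsTo hz)
  -- first extraction
  obtain ⟨σ₁, hσ₁, G, hG⟩ := aux_montel hSo (fun n z => auxTau w₀ (f n z))
    (fun n => (auxTau_diff hw₀).comp (hfdiff n) (hfS n))
    (fun n z hz => (auxTau_lt hw₀ (hfS n z hz)).le)
  -- inverse maps
  let h : ℕ → ℂ → ℂ := fun n => Function.invFunOn (f n) S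
  have hhl : ∀ n, ∀ z ∈ S, h n (f n z) = z := fun n z hz =>
    (hfbij n).injOn.leftInvOn_invFunOn hz
  have hhS : ∀ n, ∀ z ∈ D n, h n z ∈ S := by
    intro n z hz
    obtain ⟨x, hx, rfl⟩ := (hfbij n).surjOn hz
    rw [hhl n x hx]; exact hx
  have hhr : ∀ n, ∀ z ∈ D n, f n (h n z) = z := by
    intro n z hz
    obtain ⟨x, hx, rfl⟩ := (hfbij n).surjOn hz
    rw [hhl n x hx]
  have hhd : ∀ n, DifferentiableOn ℂ (h n) Sig := by
    intro n z hz
    obtain ⟨x, hx, rfl⟩ := (hfbij n).surjOn (hDsupSig n hz)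
    exact (aux_inv hSo (hfdiff n) (hhl n) x hx).differentiableWithinAt
  have hhw : ∀ n, h n w₀ = w₀ := by
    intro n
    have := hhl n w₀ hw₀S
    rwa [hffix n] at this
  -- second extraction
  obtain ⟨σ₂, hσ₂, H, hH⟩ := aux_montel hSigopen (fun n z => auxTau w₀ (h (σ₁ n) z))
    (fun n => (auxTau_diff hw₀).comp (hhd _) (fun z hz => hhS _ z (hDsupSig _ hz)))
    (fun n z hz => (auxTau_lt hw₀ (hhS _ z (hDsupSig _ hz))).le)
  have hG2 := aux_sub hG hσ₂
  have hGd : DifferentiableOn ℂ G S := hG2.differentiableOn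
    (.of_forall fun n => (auxTau_diff hw₀).comp (hfdiff _) (hfS _)) hSo
  have hHd : DifferentiableOn ℂ H Sig := hH.differentiableOn
    (.of_forall fun n => (auxTau_diff hw₀).comp (hhd _)
      (fun z hz => hhS _ z (hDsupSig _ hz))) hSigopen
  have hGw : G w₀ = 0 := by
    refine tendsto_nhds_unique (hG2.tendsto_at hw₀S) ?_
    simp [hffix, auxTau_self]
  have hHw : H w₀ = 0 := by
    refine tendsto_nhds_unique (hH.tendsto_at hwSig) ?_
    simp [hhw, auxTau_self]
  have hGlt : ∀ z ∈ S, ‖G z‖ < 1 := by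
    refine aux_max hSo hScon.isPreconnected hGd (fun z hz => ?_) hw₀S hGw
    exact le_of_tendsto (hG2.tendsto_at hz).norm
      (.of_forall fun n => (auxTau_lt hw₀ (hfS _ z hz)).le)
  have hHlt : ∀ z ∈ Sig, ‖H z‖ < 1 := by
    refine aux_max hSigopen hSigconn.isPreconnected hHd (fun z hz => ?_) hwSig hHw
    exact le_of_tendsto (hH.tendsto_at hz).norm
      (.of_forall fun n => (auxTau_lt hw₀ (hhS _ z (hDsupSig _ hz))).le)
  let g : ℂ → ℂ := fun z => auxPsi w₀ (G z)
  let k : ℂ → ℂ := fun z => auxPsi w₀ (H z)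
  have hlim : TendstoLocallyUniformlyOn (fun n => f (σ₁ (σ₂ n))) g atTop S := by
    have := aux_comp Metric.isOpen_ball (auxPsi_diff w₀).continuousOn hGd.continuousOn
      (fun z hz => mem_ball_zero_iff.2 (hGlt z hz)) hG2
    refine this.congr fun n z hz => ?_
    exact auxPsi_tau hw₀ (hfS _ z hz)
  have hgd : DifferentiableOn ℂ g S :=
    (auxPsi_diff w₀).comp hGd (fun z hz => mem_ball_zero_iff.2 (hGlt z hz))
  have hkd : DifferentiableOn ℂ k Sig :=
    (auxPsi_diff w₀).comp hHd (fun z hz => mem_ball_zero_iff.2 (hHlt z hz))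
  have hgS : ∀ z ∈ S, g z ∈ S := fun z hz => auxPsi_mem hw₀ (hGlt z hz)
  have hkS : ∀ z ∈ Sig, k z ∈ S := fun z hz => auxPsi_mem hw₀ (hHlt z hz)
  have hgw : g w₀ = w₀ := by simp only [g, hGw, auxPsi_zero]
  have hkw : k w₀ = w₀ := by simp only [k, hHw, auxPsi_zero]
  have hgk : ∀ z ∈ Sig, g (k z) = z := by
    intro z hz
    have h1 : Tendsto (fun n => h (σ₁ (σ₂ n)) z) atTop (nhds (k z)) := by
      have h2 := ((auxPsi_diff w₀).continuousOn.continuousAt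
        (Metric.isOpen_ball.mem_nhds (mem_ball_zero_iff.2 (hHlt z hz)))).tendsto.comp
        (hH.tendsto_at hz)
      refine h2.congr fun n => ?_
      exact auxPsi_tau hw₀ (hhS _ z (hDsupSig _ hz))
    have h3 : Tendsto (fun n => f (σ₁ (σ₂ n)) (h (σ₁ (σ₂ n)) z)) atTop (nhds (g (k z))) := by
      refine hlim.tendsto_comp (hgd.continuousOn _ (hkS z hz)) (hkS z hz) ?_
      exact tendsto_nhdsWithin_iff.2 ⟨h1, .of_forall fun n => hhS _ z (hDsupSig _ hz)⟩
    refine tendsto_nhds_unique h3 ?_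
    simp only [hhr _ z (hDsupSig _ hz)]
    exact tendsto_const_nhds
  have hd0 : deriv g w₀ ≠ 0 := by
    intro h0
    have h1 : HasDerivAt g 0 (k w₀) := by
      rw [hkw, ← h0]
      exact (hgd.differentiableAt (hSo.mem_nhds hw₀S)).hasDerivAt
    have h2 := h1.comp w₀ (hkd.differentiableAt (hSigopen.mem_nhds hwSig)).hasDerivAt
    have h3 : HasDerivAt (g ∘ k) 1 w₀ := by
      refine (hasDerivAt_id w₀).congr_of_eventuallyEq ?_
      filter_upwards [hSigopen.mem_nhds hwSig] with z hz using hgk z hz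
    simpa using h2.unique h3
  have hinj : InjOn g S := by
    refine aux_hurwitz hSo hScon.isPreconnected (fun n => hfdiff _)
      (fun n => (hfbij _).injOn) hlim ?_
    by_contra hcon
    push Not at hcon
    refine hd0 ?_
    have : g =ᶠ[nhds w₀] fun _ => g w₀ := by
      filter_upwards [hSo.mem_nhds hw₀S] with z hz using hcon z hz w₀ hw₀S
    rw [this.deriv_eq, deriv_const]
  have hderiv : Tendsto (fun n => deriv (f (σ₁ (σ₂ n))) w₀) atTop (nhds (deriv g w₀)) :=
    (hlim.deriv (.of_forall fun n => hfdiff _) hSo).tendsto_at hw₀S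
  have him : (deriv g w₀).im = 0 := by
    refine tendsto_nhds_unique ((continuous_im.tendsto _).comp hderiv) ?_
    simp [Function.comp_def, (hfderiv _).1]
  have hre : 0 ≤ (deriv g w₀).re :=
    ge_of_tendsto' ((continuous_re.tendsto _).comp hderiv) fun n => (hfderiv _).2.le
  have hre' : 0 < (deriv g w₀).re :=
    lt_of_le_of_ne hre fun h => hd0 (Complex.ext h.symm him)
  have hsym : ∀ z ∈ S, g (reflPi z) = reflPi (g z) := by
    intro z hz
    refine tendsto_nhds_unique (hlim.tendsto_at (aux_refl_mem hz)) ?_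
    refine ((aux_refl_cont.tendsto _).comp (hlim.tendsto_at hz)).congr fun n => ?_
    exact (hfsym _ z hz).symm
  obtain ⟨hDo, hDs⟩ := aux_sc hSo hSsc hgd hinj
  refine ⟨fun n => σ₁ (σ₂ n), hσ₁.comp hσ₂, g '' S, hDo, hScon.image g hgd.continuousOn, hDs,
    fun z hz => ⟨k z, hkS z hz, hgk z hz⟩, ?_, ?_, g, hgd, hinj.bijOn_image, hgw, him, hre',
    hsym, hlim⟩
  · rintro _ ⟨z, hz, rfl⟩
    exact hgS z hz
  · have hsub : reflPi '' (g '' S) ⊆ g '' S := by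
      rintro _ ⟨_, ⟨z, hz, rfl⟩, rfl⟩
      exact ⟨reflPi z, aux_refl_mem hz, hsym z hz⟩
    refine hsub.antisymm fun y hy => ?_
    exact ⟨reflPi y, hsub ⟨y, hy, rfl⟩, aux_refl_refl y⟩
end

section
/- Say that a sequence of plane domains D_n converges to a plane domain D (written D_n →^d D) if (i) every compact subset of D is contained in all but finitely many of the D_n, and (ii) for every z₀ ∈ ∂D, dist(z₀, ∂D_n) → 0 as n → ∞. Suppose D_n →^d D, for each n the map f_n is a holomorphic injection of D_n onto a domain E_n, and f_n converges to a function f locally uniformly in D (i.e., for every compact F ⊆ D, f_n is defined on F for all large n and f_n → f uniformly on F). Then either f is constant on D, or f is a holomorphic injection of D onto some domain E; and in the latter case, E_n →^d E and f_n^{−1} → f^{−1} locally uniformly in E. -/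
open Filter Set

/-- Convergence of plane domains `D_n →^d D`: (i) every compact subset of `D` is contained
in all but finitely many `D_n`; (ii) for every `z₀ ∈ ∂D`, `dist(z₀, ∂D_n) → 0`. -/
def DomainConv (D : ℕ → Set ℂ) (D₀ : Set ℂ) : Prop :=
  (∀ F : Set ℂ, IsCompact F → F ⊆ D₀ → ∀ᶠ n in Filter.atTop, F ⊆ D n) ∧
  (∀ z₀ ∈ frontier D₀,
    Filter.Tendsto (fun n => Metric.infDist z₀ (frontier (D n))) Filter.atTop (nhds 0))

open Metric Topology in
/-- A preconnected set meeting an open set but not its frontier lies inside. -/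
lemma aux_subset_of_frontier {S T : Set ℂ} (hS : IsPreconnected S) (hT : IsOpen T)
    (hne : (S ∩ T).Nonempty) (hfr : Disjoint S (frontier T)) : S ⊆ T := by
  refine hS.subset_left_of_subset_union hT (isClosed_closure (s := T)).isOpen_compl ?_ ?_ hne
  · exact disjoint_compl_right.mono_left subset_closure |>.mono_right le_rfl
  · intro x hx
    by_cases h : x ∈ T
    · exact Or.inl h
    · right
      intro hc
      exact Set.disjoint_left.1 hfr hx (by rw [hT.frontier_eq]; exact ⟨hc, h⟩)

open Metric Topology in
/-- Locally uniform limits of eventually holomorphic functions are holomorphic. -/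
lemma aux_diff {F : ℕ → ℂ → ℂ} {F₀ : ℂ → ℂ} {U : Set ℂ} (hU : IsOpen U)
    (hd : ∀ z ∈ U, ∃ r > 0, ∀ᶠ n in atTop, DifferentiableOn ℂ (F n) (ball z r))
    (hF : TendstoLocallyUniformlyOn F F₀ atTop U) : DifferentiableOn ℂ F₀ U := by
  intro z hz
  obtain ⟨r, hr, hd⟩ := hd z hz
  have h1 : TendstoLocallyUniformlyOn F F₀ atTop (U ∩ ball z r) := hF.mono inter_subset_left
  have h2 := h1.differentiableOn (hd.mono fun n hn => hn.mono inter_subset_right)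
    (hU.inter isOpen_ball)
  exact (h2.differentiableAt ((hU.inter isOpen_ball).mem_nhds
    ⟨hz, mem_ball_self hr⟩)).differentiableWithinAt

open Metric Topology in
/-- A Hurwitz type covering lemma. -/
lemma aux_hurwitz_s9 {F : ℕ → ℂ → ℂ} {F₀ : ℂ → ℂ} {U : Set ℂ} (hU : IsOpen U)
    (hUc : IsPreconnected U)
    (hd : ∀ z ∈ U, ∃ r > 0, ∀ᶠ n in atTop, DifferentiableOn ℂ (F n) (ball z r))
    (hF : TendstoLocallyUniformlyOn F F₀ atTop U) (hnc : ¬ ∃ c, ∀ z ∈ U, F₀ z = c)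
    {z₀ : ℂ} (hz₀ : z₀ ∈ U) {r : ℝ} (hr : 0 < r) :
    ∃ δ > 0, ∀ᶠ n in atTop, ball (F₀ z₀) δ ⊆ F n '' closedBall z₀ r := by
  have hD := aux_diff hU hd hF
  have hA : AnalyticOnNhd ℂ F₀ U := hD.analyticOnNhd hU
  obtain ⟨r₁, hr₁, hd⟩ := hd z₀ hz₀
  have hne : ∀ᶠ z in 𝓝[≠] z₀, F₀ z ≠ F₀ z₀ := by
    rcases (hA z₀ hz₀).eventually_eq_or_eventually_ne (analyticAt_const (v := F₀ z₀)) with h | h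
    · exact absurd ⟨F₀ z₀, fun z hz => (hA.eqOn_of_preconnected_of_eventuallyEq
        (analyticOnNhd_const) hUc hz₀ h) hz⟩ hnc
    · exact h
  have hev : ∀ᶠ z in 𝓝 z₀, z ∈ U ∧ z ∈ ball z₀ r₁ ∧ (z ≠ z₀ → F₀ z ≠ F₀ z₀) := by
    filter_upwards [hU.mem_nhds hz₀, ball_mem_nhds z₀ hr₁, eventually_nhdsWithin_iff.1 hne]
      with z h1 h2 h3 using ⟨h1, h2, h3⟩
  obtain ⟨ρ', hρ', hs'⟩ := nhds_basis_closedBall.mem_iff.1 hev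
  set ρ := min ρ' r with hρdef
  have hρ : 0 < ρ := lt_min hρ' hr
  have hs : ∀ z ∈ closedBall z₀ ρ, z ∈ U ∧ z ∈ ball z₀ r₁ ∧ (z ≠ z₀ → F₀ z ≠ F₀ z₀) :=
    fun z hz => hs' (closedBall_subset_closedBall (min_le_left _ _) hz)
  have hcont : ContinuousOn (fun z => ‖F₀ z - F₀ z₀‖) (sphere z₀ ρ) :=
    ((hD.continuousOn.mono fun z hz => (hs z (sphere_subset_closedBall hz)).1).sub
      continuousOn_const).norm
  obtain ⟨x, hx, hmin⟩ := (isCompact_sphere z₀ ρ).exists_isMinOn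
    (NormedSpace.sphere_nonempty.mpr hρ.le) hcont
  set m := ‖F₀ x - F₀ z₀‖ with hm
  have hmpos : 0 < m := norm_sub_pos_iff.mpr
    ((hs x (sphere_subset_closedBall hx)).2.2 (ne_of_mem_sphere hx hρ.ne'))
  have hunif : TendstoUniformlyOn F F₀ atTop (closedBall z₀ ρ) :=
    (tendstoLocallyUniformlyOn_iff_forall_isCompact hU).1 hF _
      (fun z hz => (hs z hz).1) (isCompact_closedBall _ _)
  refine ⟨m / 8, by positivity, ?_⟩
  filter_upwards [hd, Metric.tendstoUniformlyOn_iff.1 hunif (m / 8) (by positivity)] with n hn hc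
  have hdc : DiffContOnCl ℂ (F n) (ball z₀ ρ) := by
    apply DifferentiableOn.diffContOnCl
    rw [closure_ball _ hρ.ne']
    exact hn.mono fun z hz => (hs z hz).2.1
  have hc0 := hc z₀ (mem_closedBall_self hρ.le)
  have hsph : ∀ z ∈ sphere z₀ ρ, m / 2 ≤ ‖F n z - F n z₀‖ := by
    intro z hz
    have h1 := hc z (sphere_subset_closedBall hz)
    have h2 : m ≤ dist (F₀ z) (F₀ z₀) := by rw [dist_eq_norm]; exact hmin hz
    rw [← dist_eq_norm]
    have h3 := dist_triangle4 (F₀ z) (F n z) (F n z₀) (F₀ z₀)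
    rw [dist_comm (F n z₀)] at h3
    linarith
  have hfr : ∃ᶠ z in 𝓝 z₀, F n z ≠ F n z₀ := by
    by_contra hcon
    rw [not_frequently] at hcon
    simp only [not_not] at hcon
    have := (hn.analyticOnNhd isOpen_ball).eqOn_of_preconnected_of_eventuallyEq
      (analyticOnNhd_const (v := F n z₀)) (convex_ball z₀ r₁).isPreconnected
      (mem_ball_self hr₁) hcon
    have h2 := this (hs x (sphere_subset_closedBall hx)).2.1
    have h3 := hsph x hx
    simp only at h2
    rw [h2, sub_self, norm_zero] at h3
    linarith
  have key := hdc.ball_subset_image_closedBall hρ hsph hfr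
  refine Subset.trans ?_ (key.trans (image_mono (closedBall_subset_closedBall (min_le_right _ _))))
  intro w hw
  rw [mem_ball] at hw ⊢
  have := dist_triangle w (F₀ z₀) (F n z₀)
  linarith

open Metric Topology in
/-- Images of open sets under holomorphic injections are open. -/
lemma aux_isOpen_image {f : ℂ → ℂ} {D : Set ℂ} (hD : IsOpen D)
    (hf : DifferentiableOn ℂ f D) (hinj : InjOn f D) {V : Set ℂ} (hV : IsOpen V) (hVD : V ⊆ D) :
    IsOpen (f '' V) := by
  rw [isOpen_iff_mem_nhds]
  rintro _ ⟨z, hz, rfl⟩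
  rcases ((hf.analyticOnNhd hD) z (hVD hz)).eventually_constant_or_nhds_le_map_nhds with h | h
  · exfalso
    have h1 : ∀ᶠ w in 𝓝 z, w = z := by
      filter_upwards [h, hD.mem_nhds (hVD hz)] with w hw hwD using hinj hwD (hVD hz) hw
    have h2 : ∀ᶠ w in 𝓝[≠] z, False := by
      filter_upwards [h1.filter_mono nhdsWithin_le_nhds, self_mem_nhdsWithin] with w h1 h2
      exact h2 h1
    exact h2.exists.elim fun _ h => h
  · exact h (image_mem_map (hV.mem_nhds hz))

open Metric Topology in
/-- The inverse of a holomorphic injection is holomorphic. -/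
lemma aux_inv_diff {f : ℂ → ℂ} {D : Set ℂ} (hD : IsOpen D)
    (hf : DifferentiableOn ℂ f D) (hinj : InjOn f D) :
    DifferentiableOn ℂ (Function.invFunOn f D) (f '' D) := by
  set g := Function.invFunOn f D with hg
  have hE : IsOpen (f '' D) := aux_isOpen_image hD hf hinj hD Subset.rfl
  have hgf : ∀ z ∈ D, g (f z) = z := fun z hz => hinj.leftInvOn_invFunOn hz
  have hfg : ∀ w ∈ f '' D, f (g w) = w := fun w hw => Function.invFunOn_eq hw
  have hgD : ∀ w ∈ f '' D, g w ∈ D := fun w hw => Function.invFunOn_mem hw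
  have hcont : ∀ w ∈ f '' D, ContinuousAt g w := by
    rintro _ ⟨z, hz, rfl⟩
    intro V hV
    rw [hgf z hz] at hV
    obtain ⟨W, hWV, hW, hzW⟩ := _root_.mem_nhds_iff.1 (inter_mem hV (hD.mem_nhds hz))
    have := (aux_isOpen_image hD hf hinj hW (fun x hx => (hWV hx).2)).mem_nhds
      (mem_image_of_mem f hzW)
    refine mem_map.2 (mem_of_superset this ?_)
    rintro _ ⟨x, hx, rfl⟩
    simp only [mem_preimage]
    rw [hgf x (hWV hx).2]
    exact (hWV hx).1
  have hnz : ∀ w ∈ f '' D, deriv f (g w) ≠ 0 → DifferentiableAt ℂ g w := by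
    intro w hw hne
    have h1 : HasDerivAt f (deriv f (g w)) (g w) :=
      (hf.differentiableAt (hD.mem_nhds (hgD w hw))).hasDerivAt
    refine (HasDerivAt.of_local_left_inverse (hcont w hw) h1 hne ?_).differentiableAt
    filter_upwards [hE.mem_nhds hw] with y hy using hfg y hy
  intro w hw
  have hA : AnalyticOnNhd ℂ f D := hf.analyticOnNhd hD
  have hz : g w ∈ D := hgD w hw
  have hne : ∀ᶠ z in 𝓝[≠] (g w), deriv f z ≠ 0 := by
    rcases (hA (g w) hz).deriv.eventually_eq_zero_or_eventually_ne_zero with h | h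
    · exfalso
      obtain ⟨r, hr, hrs⟩ := Metric.eventually_nhds_iff_ball.1 (h.and (hD.mem_nhds hz))
      obtain ⟨y, hy, hyne⟩ : ∃ y ∈ ball (g w) r, y ≠ g w := by
        refine ⟨g w + (r / 2 : ℝ), ?_, ?_⟩
        · simp [mem_ball, dist_eq_norm, abs_of_pos hr]; linarith
        · simp; exact hr.ne'
      have := (convex_ball (g w) r).is_const_of_fderivWithin_eq_zero (𝕜 := ℂ) (f := f)
        (hf.mono fun y hy => (hrs y hy).2) (fun x hx => by
          rw [fderivWithin_of_isOpen isOpen_ball hx]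
          ext
          simpa using (hrs x hx).1) hy (mem_ball_self hr)
      exact hyne (hinj (hrs y hy).2 hz this)
    · exact h
  have : AnalyticAt ℂ g w := by
    apply Complex.analyticAt_of_differentiable_on_punctured_nhds_of_continuousAt _ (hcont w hw)
    have ht : Tendsto g (𝓝[≠] w) (𝓝[≠] (g w)) := by
      refine tendsto_nhdsWithin_iff.2 ⟨(hcont w hw).mono_left nhdsWithin_le_nhds, ?_⟩
      filter_upwards [self_mem_nhdsWithin, nhdsWithin_le_nhds (hE.mem_nhds hw)] with y hy hyE
      intro hyw
      apply hy
      rw [mem_singleton_iff] at hyw ⊢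
      rw [← hfg y hyE, hyw, hfg w hw]
    filter_upwards [ht.eventually hne, nhdsWithin_le_nhds (hE.mem_nhds hw)] with y h1 h2
      using hnz y h2 h1
  exact this.differentiableAt.differentiableWithinAt

open Metric Topology in
/-- A three circles type estimate. -/
lemma aux_three {u : ℂ → ℂ} {c : ℂ} {s R M ε : ℝ} (hs : 0 < s) (hsR : s < R) (hM : 0 ≤ M)
    (hε : 0 ≤ ε)
    (hu : ∀ z, s ≤ dist z c → dist z c ≤ R → DifferentiableAt ℂ u z)
    (h1 : ∀ z ∈ sphere c R, ‖u z‖ ≤ M) (h2 : ∀ z ∈ sphere c s, ‖u z‖ ≤ ε) (q : ℕ)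
    {z : ℂ} (hz : s ≤ dist z c) (hz' : dist z c ≤ R) :
    ‖u z‖ ≤ (dist z c / R) ^ q * M + (dist z c / s) ^ q * ε := by
  have hR : 0 < R := hs.trans hsR
  set A : Set ℂ := {z | s < dist z c ∧ dist z c < R} with hA
  by_cases hzs : dist z c = s
  · have := h2 z hzs
    rw [hzs, div_self hs.ne', one_pow, one_mul]
    have : 0 ≤ (s / R) ^ q * M := by positivity
    linarith
  by_cases hzR : dist z c = R
  · have := h1 z hzR
    rw [hzR, div_self hR.ne', one_pow, one_mul]
    have : 0 ≤ (R / s) ^ q * ε := by positivity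
    linarith
  have hzA : z ∈ A := ⟨lt_of_le_of_ne hz (Ne.symm hzs), lt_of_le_of_ne hz' hzR⟩
  have hdc : Continuous (fun z : ℂ => dist z c) := by fun_prop
  have hclA : closure A ⊆ {z | s ≤ dist z c ∧ dist z c ≤ R} := by
    refine closure_minimal (fun x hx => ⟨hx.1.le, hx.2.le⟩) ?_
    exact (isClosed_le continuous_const hdc).inter (isClosed_le hdc continuous_const)
  have hAo : IsOpen A := (isOpen_lt continuous_const hdc).inter (isOpen_lt hdc continuous_const)
  have hbd : Bornology.IsBounded A := isBounded_ball.subset (fun x hx => hx.2 : A ⊆ ball c R)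
  set v : ℂ → ℂ := fun z => u z / (z - c) ^ q with hv
  have hvn : ∀ x, ‖v x‖ = ‖u x‖ / dist x c ^ q := by
    intro x; simp [hv, dist_eq_norm]
  have key := Complex.norm_le_of_forall_mem_frontier_norm_le (f := v) (U := A)
    (C := M / R ^ q + ε / s ^ q) hbd ?_ ?_ (subset_closure hzA)
  · rw [hvn, div_le_iff₀ (pow_pos (hs.trans_le hz) q)] at key
    refine key.trans (le_of_eq ?_)
    rw [div_pow, div_pow]; ring
  · apply DifferentiableOn.diffContOnCl
    intro x hx
    have hx := hclA hx
    have : x - c ≠ 0 := by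
      intro h
      rw [sub_eq_zero] at h
      have h3 : s ≤ dist x c := hx.1
      rw [h, dist_self] at h3
      linarith
    exact ((hu x hx.1 hx.2).div (by fun_prop : DifferentiableAt ℂ (fun z => (z - c) ^ q) x)
      (pow_ne_zero q this)).differentiableWithinAt
  · intro x hx
    rw [hAo.frontier_eq] at hx
    have hx1 := hclA hx.1
    rw [hvn]
    have hp1 : 0 ≤ M / R ^ q := by positivity
    have hp2 : 0 ≤ ε / s ^ q := by positivity
    by_cases hxs : dist x c = s
    · have := div_le_div_of_nonneg_right (h2 x hxs) (pow_pos hs q).le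
      rw [hxs]; linarith
    by_cases hxR : dist x c = R
    · have := div_le_div_of_nonneg_right (h1 x hxR) (pow_pos hR q).le
      rw [hxR]; linarith
    exact absurd ⟨lt_of_le_of_ne hx1.1 (Ne.symm hxs), lt_of_le_of_ne hx1.2 hxR⟩ hx.2

open Metric Topology in
/-- Convergence on the inner circle plus boundedness gives convergence inside an annulus. -/
lemma aux_vitali {P : ℕ → ℂ → ℂ} {c : ℂ} {s R R' M : ℝ} (hs : 0 < s) (hsR' : s < R')
    (hR'R : R' < R) (hM : 0 ≤ M)
    (hd : ∀ᶠ n in atTop, ∀ z, s ≤ dist z c → dist z c ≤ R → DifferentiableAt ℂ (P n) z)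
    (hb : ∀ᶠ n in atTop, ∀ z ∈ sphere c R, ‖P n z‖ ≤ M)
    (hc : UniformCauchySeqOn P atTop (sphere c s)) :
    UniformCauchySeqOn P atTop {z | s ≤ dist z c ∧ dist z c ≤ R'} := by
  have hR' : 0 < R' := hs.trans hsR'
  have hR : 0 < R := hR'.trans hR'R
  rw [Metric.uniformCauchySeqOn_iff] at hc ⊢
  intro ε hε
  obtain ⟨q, hq⟩ : ∃ q : ℕ, (R' / R) ^ q * (2 * M) < ε / 2 := by
    have ht := (tendsto_pow_atTop_nhds_zero_of_lt_one (r := R' / R) (by positivity)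
      ((div_lt_one hR).2 hR'R)).mul_const (2 * M)
    rw [zero_mul] at ht
    exact (ht.eventually (gt_mem_nhds (half_pos hε))).exists
  have hpos : 0 < (R' / s) ^ q := by positivity
  obtain ⟨N, hN⟩ := hc (ε / 2 / (R' / s) ^ q) (by positivity)
  obtain ⟨N', hN'⟩ := eventually_atTop.1 (hd.and hb)
  refine ⟨max N N', fun m hm n hn z hz => ?_⟩
  have hm' := hN' m (le_trans (le_max_right _ _) hm)
  have hn' := hN' n (le_trans (le_max_right _ _) hn)
  have key := aux_three (u := fun z => P m z - P n z) (M := 2 * M)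
    (ε := ε / 2 / (R' / s) ^ q) hs (hsR'.trans hR'R) (by positivity)
    (by positivity) (fun x h1 h2 => (hm'.1 x h1 h2).sub (hn'.1 x h1 h2))
    (fun x hx => by
      have := norm_sub_le (P m x) (P n x)
      linarith [hm'.2 x hx, hn'.2 x hx])
    (fun x hx => by
      have := hN m (le_trans (le_max_left _ _) hm) n (le_trans (le_max_left _ _) hn) x hx
      rw [dist_eq_norm] at this
      exact this.le) q hz.1 (hz.2.trans hR'R.le)
  rw [dist_eq_norm]
  have e1 : (dist z c / R) ^ q * (2 * M) ≤ (R' / R) ^ q * (2 * M) := by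
    gcongr; exact hz.2
  have e2 : (dist z c / s) ^ q * (ε / 2 / (R' / s) ^ q) ≤
      (R' / s) ^ q * (ε / 2 / (R' / s) ^ q) := by
    gcongr; exact hz.2
  rw [mul_div_cancel₀ _ hpos.ne'] at e2
  linarith

open Metric Topology in
lemma aux_locd {D : ℕ → Set ℂ} {D₀ : Set ℂ} {f : ℕ → ℂ → ℂ} (hD₀ : IsOpen D₀)
    (hi : ∀ F : Set ℂ, IsCompact F → F ⊆ D₀ → ∀ᶠ n in atTop, F ⊆ D n)
    (hfd : ∀ n, DifferentiableOn ℂ (f n) (D n)) :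
    ∀ z ∈ D₀, ∃ r > 0, ∀ᶠ n in atTop, DifferentiableOn ℂ (f n) (ball z r) := by
  intro z hz
  obtain ⟨r, hr, hrs⟩ := nhds_basis_closedBall.mem_iff.1 (hD₀.mem_nhds hz)
  refine ⟨r, hr, (hi _ (isCompact_closedBall z r) hrs).mono fun n hn => ?_⟩
  exact (hfd n).mono (ball_subset_closedBall.trans hn)

open Metric Topology in
lemma aux_cover {D : ℕ → Set ℂ} {D₀ : Set ℂ} {f : ℕ → ℂ → ℂ} {f₀ : ℂ → ℂ} (hD₀ : IsOpen D₀)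
    (hD₀c : IsPreconnected D₀)
    (hi : ∀ F : Set ℂ, IsCompact F → F ⊆ D₀ → ∀ᶠ n in atTop, F ⊆ D n)
    (hfd : ∀ n, DifferentiableOn ℂ (f n) (D n))
    (hlu : TendstoLocallyUniformlyOn f f₀ atTop D₀) (hnc : ¬ ∃ c, ∀ z ∈ D₀, f₀ z = c)
    {z : ℂ} (hz : z ∈ D₀) {r : ℝ} (hr : 0 < r) :
    ∃ δ > 0, ∀ᶠ n in atTop, ball (f₀ z) δ ⊆ f n '' (closedBall z r ∩ D n) := by
  obtain ⟨ρ, hρ, hρs⟩ := nhds_basis_closedBall.mem_iff.1 (hD₀.mem_nhds hz)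
  obtain ⟨δ, hδ, h⟩ := aux_hurwitz_s9 hD₀ hD₀c (aux_locd hD₀ hi hfd) hlu hnc hz (lt_min hr hρ)
  refine ⟨δ, hδ, ?_⟩
  filter_upwards [h, hi _ (isCompact_closedBall z ρ) hρs] with n h1 h2
  refine h1.trans (image_mono fun x hx => ⟨?_, h2 ?_⟩)
  · exact closedBall_subset_closedBall (min_le_left _ _) hx
  · exact closedBall_subset_closedBall (min_le_right _ _) hx

open Metric Topology in
lemma aux_inj {D : ℕ → Set ℂ} {D₀ : Set ℂ} {f : ℕ → ℂ → ℂ} {f₀ : ℂ → ℂ} (hD₀ : IsOpen D₀)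
    (hD₀c : IsPreconnected D₀)
    (hi : ∀ F : Set ℂ, IsCompact F → F ⊆ D₀ → ∀ᶠ n in atTop, F ⊆ D n)
    (hfd : ∀ n, DifferentiableOn ℂ (f n) (D n)) (hfi : ∀ n, InjOn (f n) (D n))
    (hlu : TendstoLocallyUniformlyOn f f₀ atTop D₀) (hnc : ¬ ∃ c, ∀ z ∈ D₀, f₀ z = c) :
    InjOn f₀ D₀ := by
  intro x hx y hy hxy
  by_contra hne
  have hd : 0 < dist x y := dist_pos.2 hne
  obtain ⟨δ, hδ, h⟩ := aux_cover hD₀ hD₀c hi hfd hlu hnc hx (r := dist x y / 3) (by positivity)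
  obtain ⟨δ', hδ', h'⟩ := aux_cover hD₀ hD₀c hi hfd hlu hnc hy (r := dist x y / 3) (by positivity)
  obtain ⟨n, hn, hn'⟩ := (h.and h').exists
  obtain ⟨u, hu, hu'⟩ := hn (mem_ball_self hδ)
  obtain ⟨v, hv, hv'⟩ := hn' (mem_ball_self hδ')
  have huv : u = v := hfi n hu.2 hv.2 (by rw [hu', hv', hxy])
  subst huv
  have h1 := mem_closedBall.1 hu.1
  have h2 := mem_closedBall.1 hv.1
  have := dist_triangle_left x y u
  linarith

open Metric Topology in
lemma aux_compact {D : ℕ → Set ℂ} {D₀ : Set ℂ} {f : ℕ → ℂ → ℂ} {f₀ : ℂ → ℂ} (hD₀ : IsOpen D₀)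
    (hD₀c : IsPreconnected D₀)
    (hi : ∀ F : Set ℂ, IsCompact F → F ⊆ D₀ → ∀ᶠ n in atTop, F ⊆ D n)
    (hfd : ∀ n, DifferentiableOn ℂ (f n) (D n))
    (hlu : TendstoLocallyUniformlyOn f f₀ atTop D₀) (hnc : ¬ ∃ c, ∀ z ∈ D₀, f₀ z = c) :
    ∀ F : Set ℂ, IsCompact F → F ⊆ f₀ '' D₀ → ∀ᶠ n in atTop, F ⊆ f n '' D n := by
  intro F hF hFE
  refine hF.induction_on (p := fun K => ∀ᶠ n in atTop, K ⊆ f n '' D n) ?_ ?_ ?_ ?_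
  · simp
  · intro s t hst ht
    exact ht.mono fun n hn => hst.trans hn
  · intro s t hs ht
    filter_upwards [hs, ht] with n h1 h2 using union_subset h1 h2
  · intro w hw
    obtain ⟨z, hz, rfl⟩ := hFE hw
    obtain ⟨δ, hδ, h⟩ := aux_cover hD₀ hD₀c hi hfd hlu hnc hz one_pos
    exact ⟨ball (f₀ z) δ, nhdsWithin_le_nhds (ball_mem_nhds _ hδ),
      h.mono fun n hn => hn.trans (image_mono inter_subset_right)⟩

open Metric Topology in
lemma aux_inv_conv {D : ℕ → Set ℂ} {D₀ : Set ℂ} {f : ℕ → ℂ → ℂ} {f₀ : ℂ → ℂ} (hD₀ : IsOpen D₀)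
    (hD₀c : IsPreconnected D₀)
    (hi : ∀ F : Set ℂ, IsCompact F → F ⊆ D₀ → ∀ᶠ n in atTop, F ⊆ D n)
    (hfd : ∀ n, DifferentiableOn ℂ (f n) (D n)) (hfi : ∀ n, InjOn (f n) (D n))
    (hlu : TendstoLocallyUniformlyOn f f₀ atTop D₀) (hnc : ¬ ∃ c, ∀ z ∈ D₀, f₀ z = c) :
    TendstoLocallyUniformlyOn (fun n => Function.invFunOn (f n) (D n))
        (Function.invFunOn f₀ D₀) atTop (f₀ '' D₀) := by
  have hd₀ := aux_diff hD₀ (aux_locd hD₀ hi hfd) hlu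
  have hi₀ := aux_inj hD₀ hD₀c hi hfd hfi hlu hnc
  rw [Metric.tendstoLocallyUniformlyOn_iff]
  rintro ε hε _ ⟨z, hz, rfl⟩
  obtain ⟨δ, hδ, h⟩ := aux_cover hD₀ hD₀c hi hfd hlu hnc hz (r := ε / 3) (by positivity)
  have ho : IsOpen (f₀ '' (ball z (ε / 3) ∩ D₀)) :=
    aux_isOpen_image hD₀ hd₀ hi₀ (isOpen_ball.inter hD₀) inter_subset_right
  refine ⟨ball (f₀ z) δ ∩ f₀ '' (ball z (ε / 3) ∩ D₀), nhdsWithin_le_nhds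
    (inter_mem (ball_mem_nhds _ hδ) (ho.mem_nhds ⟨z, ⟨mem_ball_self (by positivity), hz⟩, rfl⟩)), ?_⟩
  filter_upwards [h] with n hn
  rintro y ⟨hy1, x, hx, rfl⟩
  obtain ⟨x', hx', he⟩ := hn hy1
  rw [hi₀.leftInvOn_invFunOn hx.2, ← he, (hfi n).leftInvOn_invFunOn hx'.2]
  have h1 := mem_ball.1 hx.1
  have h2 := mem_closedBall.1 hx'.1
  have := dist_triangle_right x x' z
  linarith

open Metric Topology in
lemma aux_not_const {h : ℂ → ℂ} {V U : Set ℂ} (hV : IsOpen V) (hne : V.Nonempty) (hVU : V ⊆ U)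
    (hinj : InjOn h V) : ¬ ∃ c, ∀ z ∈ U, h z = c := by
  rintro ⟨c, hc⟩
  obtain ⟨x, hx⟩ := hne
  have h1 : ∀ᶠ w in 𝓝 x, w = x := by
    filter_upwards [hV.mem_nhds hx] with w hw
    exact hinj hw hx (by rw [hc w (hVU hw), hc x (hVU hx)])
  have h2 : ∀ᶠ w in 𝓝[≠] x, False := by
    filter_upwards [h1.filter_mono nhdsWithin_le_nhds, self_mem_nhdsWithin] with w h1 h2
    exact h2 h1
  exact h2.exists.elim fun _ h => h

open Metric Topology in
/-- The key step: a boundary point of the limit domain cannot have a fixed neighbourhood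
contained in all image domains. -/
lemma aux_key {D : ℕ → Set ℂ} {D₀ : Set ℂ} {f : ℕ → ℂ → ℂ} {f₀ : ℂ → ℂ}
    (hDo : ∀ n, IsOpen (D n)) (hDc : ∀ n, IsConnected (D n)) (hDp : ∀ n, D n ≠ univ)
    (hD₀ : IsOpen D₀) (hD₀c : IsPreconnected D₀) (hconv : DomainConv D D₀)
    (hfd : ∀ n, DifferentiableOn ℂ (f n) (D n)) (hfi : ∀ n, InjOn (f n) (D n))
    (hlu : TendstoLocallyUniformlyOn f f₀ atTop D₀) (hnc : ¬ ∃ c, ∀ z ∈ D₀, f₀ z = c)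
    {w₀ : ℂ} (hw₀ : w₀ ∈ closure (f₀ '' D₀)) {δ : ℝ} (hδ : 0 < δ)
    (hball : ∀ n, ball w₀ δ ⊆ f n '' D n) : w₀ ∈ f₀ '' D₀ := by
  by_contra hw₀E
  have hi := hconv.1
  have hd₀ := aux_diff hD₀ (aux_locd hD₀ hi hfd) hlu
  have hi₀ := aux_inj hD₀ hD₀c hi hfd hfi hlu hnc
  have hgconv := aux_inv_conv hD₀ hD₀c hi hfd hfi hlu hnc
  set E := f₀ '' D₀ with hE
  have hEo : IsOpen E := aux_isOpen_image hD₀ hd₀ hi₀ hD₀ Subset.rfl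
  set g : ℕ → ℂ → ℂ := fun n => Function.invFunOn (f n) (D n) with hg
  set g₀ : ℂ → ℂ := Function.invFunOn f₀ D₀ with hg₀
  have hfg₀ : ∀ w ∈ E, f₀ (g₀ w) = w := fun w hw => Function.invFunOn_eq hw
  have hg₀D : ∀ w ∈ E, g₀ w ∈ D₀ := fun w hw => Function.invFunOn_mem hw
  have hg₀inj : InjOn g₀ E := fun x hx y hy hxy => by rw [← hfg₀ x hx, hxy, hfg₀ y hy]
  have hg₀cont : ContinuousOn g₀ E := (aux_inv_diff hD₀ hd₀ hi₀).continuousOn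
  have hfg : ∀ n, ∀ w ∈ ball w₀ δ, f n (g n w) = w :=
    fun n w hw => Function.invFunOn_eq (hball n hw)
  have hgD : ∀ n, ∀ w ∈ ball w₀ δ, g n w ∈ D n :=
    fun n w hw => Function.invFunOn_mem (hball n hw)
  have hginj : ∀ n, InjOn (g n) (ball w₀ δ) :=
    fun n x hx y hy hxy => by rw [← hfg n x hx, hxy, hfg n y hy]
  have hgd : ∀ n, DifferentiableOn ℂ (g n) (ball w₀ δ) :=
    fun n => (aux_inv_diff (hDo n) (hfd n) (hfi n)).mono (hball n)
  have hlocg : ∀ U : Set ℂ, IsOpen U → U ⊆ ball w₀ δ → ∀ z ∈ U, ∃ r > 0, ∀ᶠ n in atTop,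
      DifferentiableOn ℂ (g n) (ball z r) := by
    intro U hU hUs z hz
    obtain ⟨r, hr, hrs⟩ := Metric.isOpen_iff.1 hU z hz
    exact ⟨r, hr, Eventually.of_forall fun n => (hgd n).mono (hrs.trans hUs)⟩
  -- the nearby point `w₁`
  obtain ⟨w₁, hw₁E, hw₁⟩ := Metric.mem_closure_iff.1 hw₀ (δ / 4) (by positivity)
  obtain ⟨s₂, hs₂, hs₂E⟩ := nhds_basis_closedBall.mem_iff.1 (hEo.mem_nhds hw₁E)
  obtain ⟨s, hs, hss⟩ : ∃ s > 0, s₂ = 2 * s := ⟨s₂ / 2, by positivity, by ring⟩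
  subst hss
  have hd1 : 2 * s < dist w₀ w₁ := by
    by_contra h
    exact hw₀E (hs₂E (mem_closedBall.2 (not_lt.1 h)))
  set a := g₀ w₁ with ha
  have hsub : closedBall w₁ (2 * s) ⊆ ball w₀ δ := by
    intro x hx
    have h1 := mem_closedBall.1 hx
    have h2 := dist_triangle_right x w₀ w₁
    rw [mem_ball]; linarith
  obtain ⟨δ₁, hδ₁, hcov⟩ := aux_hurwitz_s9 (F := g) (F₀ := g₀) (U := ball w₁ (2 * s)) isOpen_ball
    (convex_ball _ _).isPreconnected (hlocg _ isOpen_ball (ball_subset_closedBall.trans hsub))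
    (hgconv.mono (ball_subset_closedBall.trans hs₂E))
    (aux_not_const isOpen_ball ⟨w₁, mem_ball_self hs₂⟩ Subset.rfl
      (hg₀inj.mono (ball_subset_closedBall.trans hs₂E))) (mem_ball_self hs₂) hs
  have hlow : ∀ᶠ n in atTop, ∀ w ∈ ball w₀ δ, s < dist w w₁ → δ₁ ≤ ‖g n w - a‖ := by
    filter_upwards [hcov] with n hn w hw hsw
    by_contra hlt
    obtain ⟨w', hw', he⟩ := hn (mem_ball_iff_norm.2 (not_le.1 hlt))
    have hw'' := mem_closedBall.1 hw'
    have : w' = w := hginj n (hsub (closedBall_subset_closedBall (by linarith) hw')) hw he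
    rw [this] at hw''
    linarith
  set P : ℕ → ℂ → ℂ := fun n w => (g n w - a)⁻¹ with hP
  have hPE : TendstoLocallyUniformlyOn P (fun w => (g₀ w - a)⁻¹) atTop (E \ {w₁}) := by
    have h1 : TendstoLocallyUniformlyOn (fun n w => g n w - a) (fun w => g₀ w - a) atTop
        (E \ {w₁}) := by
      have := hgconv.mono (diff_subset : E \ {w₁} ⊆ E)
      rw [Metric.tendstoLocallyUniformlyOn_iff] at this ⊢
      simpa only [dist_sub_right] using this
    refine h1.fun_inv₀ ((hg₀cont.mono diff_subset).sub continuousOn_const) ?_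
    intro x hx h
    exact hx.2 (hg₀inj hx.1 hw₁E (sub_eq_zero.1 h))
  have hPd : ∀ᶠ n in atTop, ∀ z ∈ ball w₀ δ, s < dist z w₁ → DifferentiableAt ℂ (P n) z := by
    filter_upwards [hlow] with n hn z hz hsz
    refine (((hgd n).differentiableAt (isOpen_ball.mem_nhds hz)).sub_const a).inv ?_
    intro h
    have := hn z hz hsz
    rw [h, norm_zero] at this
    linarith
  have hin : ∀ z, dist z w₁ ≤ δ / 2 → z ∈ ball w₀ δ := by
    intro z hz
    have h2 := dist_triangle_right z w₀ w₁
    rw [mem_ball]; linarith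
  have hcau : UniformCauchySeqOn P atTop {z | 3 / 2 * s ≤ dist z w₁ ∧ dist z w₁ ≤ 3 / 8 * δ} := by
    refine aux_vitali (R := δ / 2) (M := δ₁⁻¹) (by positivity) (by linarith) (by linarith)
      (by positivity) ?_ ?_ ?_
    · filter_upwards [hPd] with n hn z h1 h2 using hn z (hin z h2) (by linarith)
    · filter_upwards [hlow] with n hn z hz
      have hz' : dist z w₁ = δ / 2 := hz
      have := hn z (hin z hz'.le) (by linarith)
      simp only [hP, norm_inv]
      exact inv_anti₀ hδ₁ this
    · have : TendstoUniformlyOn P (fun w => (g₀ w - a)⁻¹) atTop (sphere w₁ (3 / 2 * s)) := by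
        refine (tendstoLocallyUniformlyOn_iff_forall_isCompact
          (hEo.sdiff isClosed_singleton)).1 hPE _ ?_ (isCompact_sphere _ _)
        intro x hx
        refine ⟨hs₂E ?_, ?_⟩
        · rw [mem_closedBall, mem_sphere.1 hx]; linarith
        · exact ne_of_mem_sphere hx (by positivity)
      exact this.uniformCauchySeqOn
  -- the ball around `w₀`
  obtain ⟨r₀, hr₀, hr₀1, hr₀2⟩ : ∃ r₀ > 0, r₀ ≤ dist w₀ w₁ - 3 / 2 * s ∧ r₀ ≤ δ / 8 :=
    ⟨min (dist w₀ w₁ - 3 / 2 * s) (δ / 8), lt_min (by linarith) (by positivity),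
      min_le_left _ _, min_le_right _ _⟩
  set U := ball w₀ r₀ with hU
  have hUo : IsOpen U := isOpen_ball
  have hUc : IsPreconnected U := (convex_ball _ _).isPreconnected
  have hUδ : U ⊆ ball w₀ δ := ball_subset_ball (by linarith)
  have hUann : U ⊆ {z | 3 / 2 * s ≤ dist z w₁ ∧ dist z w₁ ≤ 3 / 8 * δ} := by
    intro z hz
    have h1 := mem_ball.1 hz
    have h2 := dist_triangle_left w₀ w₁ z
    have h3 := dist_triangle z w₀ w₁
    constructor <;> linarith
  have hlowU : ∀ᶠ n in atTop, ∀ w ∈ U, δ₁ ≤ ‖g n w - a‖ := by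
    filter_upwards [hlow] with n hn w hw
    exact hn w (hUδ hw) (by linarith [(hUann hw).1])
  have hlim : ∀ z, ∃ l, z ∈ U → Tendsto (fun n => P n z) atTop (𝓝 l) := by
    intro z
    by_cases hz : z ∈ U
    · obtain ⟨l, hl⟩ := cauchySeq_tendsto_of_complete (hcau.cauchySeq (hUann hz))
      exact ⟨l, fun _ => hl⟩
    · exact ⟨0, fun h => absurd h hz⟩
  choose P₀ hP₀ using hlim
  have hPU : TendstoLocallyUniformlyOn P P₀ atTop U :=
    ((hcau.mono hUann).tendstoUniformlyOn_of_tendsto hP₀).tendstoLocallyUniformlyOn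
  have hlocP : ∀ z ∈ U, ∃ r > 0, ∀ᶠ n in atTop, DifferentiableOn ℂ (P n) (ball z r) := by
    intro z hz
    obtain ⟨r, hr, hrs⟩ := Metric.isOpen_iff.1 hUo z hz
    refine ⟨r, hr, hPd.mono fun n hn x hx => ?_⟩
    exact (hn x (hUδ (hrs hx)) (by linarith [(hUann (hrs hx)).1])).differentiableWithinAt
  have hP₀E : ∀ w ∈ U ∩ E, P₀ w = (g₀ w - a)⁻¹ := by
    intro w hw
    refine tendsto_nhds_unique (hP₀ w hw.1) (hPE.tendsto_at ⟨hw.2, ?_⟩)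
    rintro rfl
    have := (hUann hw.1).1
    rw [dist_self] at this
    linarith
  have hUE : IsOpen (U ∩ E) := hUo.inter hEo
  obtain ⟨w₂, hw₂U, hw₂E⟩ : (U ∩ E).Nonempty :=
    mem_closure_iff_nhds.1 hw₀ U (ball_mem_nhds _ hr₀)
  have hP₀nc : ¬ ∃ c, ∀ z ∈ U, P₀ z = c := by
    refine aux_not_const hUE ⟨w₂, hw₂U, hw₂E⟩ inter_subset_left ?_
    intro x hx y hy hxy
    rw [hP₀E x hx, hP₀E y hy, inv_inj, sub_left_inj] at hxy
    exact hg₀inj hx.2 hy.2 hxy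
  have hP₀ne : ∀ p ∈ U, P₀ p ≠ 0 := by
    intro p hp h0
    obtain ⟨r, hr, hrs⟩ := nhds_basis_closedBall.mem_iff.1 (hUo.mem_nhds hp)
    obtain ⟨δ₂, hδ₂, hcov⟩ := aux_hurwitz_s9 hUo hUc hlocP hPU hP₀nc hp hr
    obtain ⟨n, hn, hn'⟩ := (hcov.and hlowU).exists
    obtain ⟨x, hx, hx0⟩ := hn (mem_ball_self hδ₂)
    rw [h0] at hx0
    have := hn' x (hrs hx)
    rw [inv_eq_zero.1 hx0, norm_zero] at this
    linarith
  set G : ℂ → ℂ := fun w => (P₀ w)⁻¹ + a with hG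
  have hgG : TendstoLocallyUniformlyOn g G atTop U := by
    have h1 := hPU.fun_inv₀ (aux_diff hUo hlocP hPU).continuousOn hP₀ne
    rw [Metric.tendstoLocallyUniformlyOn_iff] at h1 ⊢
    intro ε hε x hx
    obtain ⟨t, ht, h⟩ := h1 ε hε x hx
    refine ⟨t, ht, h.mono fun n hn y hy => ?_⟩
    have := hn y hy
    simp only [hP, inv_inv] at this
    rwa [← dist_add_right _ _ a, sub_add_cancel] at this
  have hGE : ∀ w ∈ U ∩ E, G w = g₀ w := by
    intro w hw
    simp only [hG, hP₀E w hw, inv_inv, sub_add_cancel]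
  have hGnc : ¬ ∃ c, ∀ z ∈ U, G z = c := by
    refine aux_not_const hUE ⟨w₂, hw₂U, hw₂E⟩ inter_subset_left ?_
    intro x hx y hy hxy
    rw [hGE x hx, hGE y hy] at hxy
    exact hg₀inj hx.2 hy.2 hxy
  have hGd := aux_diff hUo (hlocg U hUo hUδ) hgG
  have hGU : G '' U ⊆ D₀ := by
    refine aux_subset_of_frontier (hUc.image G hGd.continuousOn) hD₀
      ⟨G w₂, mem_image_of_mem G hw₂U, ?_⟩ ?_
    · rw [hGE w₂ ⟨hw₂U, hw₂E⟩]; exact hg₀D w₂ hw₂E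
    · rw [Set.disjoint_left]
      rintro _ ⟨p, hp, rfl⟩ hfr
      obtain ⟨r, hr, hrs⟩ := nhds_basis_closedBall.mem_iff.1 (hUo.mem_nhds hp)
      obtain ⟨δ₃, hδ₃, hcov⟩ := aux_hurwitz_s9 hUo hUc (hlocg U hUo hUδ) hgG hGnc hp hr
      have ht := (hconv.2 _ hfr).eventually (gt_mem_nhds hδ₃)
      obtain ⟨n, hn, hn'⟩ := (hcov.and ht).exists
      have hne : (frontier (D n)).Nonempty := by
        rw [nonempty_iff_ne_empty, Ne, frontier_eq_empty_iff, not_or]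
        exact ⟨(hDc n).nonempty.ne_empty, hDp n⟩
      obtain ⟨y, hy, hyd⟩ := (infDist_lt_iff hne).1 hn'
      obtain ⟨x, hx, hxy⟩ := hn (mem_ball'.2 hyd)
      rw [(hDo n).frontier_eq] at hy
      exact hy.2 (hxy ▸ hgD n x (hUδ (hrs hx)))
  have hw₀U : w₀ ∈ U := mem_ball_self hr₀
  have hz : G w₀ ∈ D₀ := hGU (mem_image_of_mem G hw₀U)
  have ht : Tendsto (fun n => f n (g n w₀)) atTop (𝓝 (f₀ (G w₀))) := by
    refine tendsto_comp_of_locally_uniform_limit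
      (hd₀.continuousOn.continuousAt (hD₀.mem_nhds hz)) (hgG.tendsto_at hw₀U) ?_
    intro u hu
    obtain ⟨t, ht, h⟩ := hlu u hu (G w₀) hz
    rw [hD₀.nhdsWithin_eq hz] at ht
    exact ⟨t, ht, h⟩
  have he : ∀ n, f n (g n w₀) = w₀ := fun n => hfg n w₀ (mem_ball_self hδ)
  simp only [he] at ht
  exact hw₀E ⟨G w₀, hz, tendsto_nhds_unique ht tendsto_const_nhds⟩

/-- Suppose `D_n →^d D`, each `f_n` is a holomorphic injection of the domain
`D_n` onto a domain `E_n`, and `f_n → f` locally uniformly in `D`. Then either `f` is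
constant on `D`, or `f` is a holomorphic injection of `D` onto some domain `E`, in which
case `E_n →^d E` and `f_n⁻¹ → f⁻¹` locally uniformly in `E`. -/
theorem statement9 (D : ℕ → Set ℂ) (D₀ : Set ℂ) (f : ℕ → ℂ → ℂ) (f₀ : ℂ → ℂ)
    (hDopen : ∀ n, IsOpen (D n)) (hDconn : ∀ n, IsConnected (D n))
    (hDproper : ∀ n, D n ≠ Set.univ)
    (hD₀open : IsOpen D₀) (hD₀conn : IsConnected D₀) (hD₀proper : D₀ ≠ Set.univ)
    (hconv : DomainConv D D₀)
    (hfdiff : ∀ n, DifferentiableOn ℂ (f n) (D n))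
    (hfinj : ∀ n, Set.InjOn (f n) (D n))
    (hlu : TendstoLocallyUniformlyOn f f₀ Filter.atTop D₀) :
    (∃ c : ℂ, ∀ z ∈ D₀, f₀ z = c) ∨
    (DifferentiableOn ℂ f₀ D₀ ∧ Set.InjOn f₀ D₀ ∧
      IsOpen (f₀ '' D₀) ∧ IsConnected (f₀ '' D₀) ∧
      DomainConv (fun n => f n '' D n) (f₀ '' D₀) ∧
      TendstoLocallyUniformlyOn (fun n => Function.invFunOn (f n) (D n))
        (Function.invFunOn f₀ D₀) Filter.atTop (f₀ '' D₀)) := by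
  by_cases hnc : ∃ c : ℂ, ∀ z ∈ D₀, f₀ z = c
  · exact Or.inl hnc
  right
  have hi := hconv.1
  have hD₀c := hD₀conn.isPreconnected
  have hd₀ := aux_diff hD₀open (aux_locd hD₀open hi hfdiff) hlu
  have hi₀ := aux_inj hD₀open hD₀c hi hfdiff hfinj hlu hnc
  have hEo : IsOpen (f₀ '' D₀) := aux_isOpen_image hD₀open hd₀ hi₀ hD₀open Subset.rfl
  have hcpt := aux_compact hD₀open hD₀c hi hfdiff hlu hnc
  refine ⟨hd₀, hi₀, hEo, hD₀conn.image f₀ hd₀.continuousOn, ⟨hcpt, ?_⟩,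
    aux_inv_conv hD₀open hD₀c hi hfdiff hfinj hlu hnc⟩
  intro w₀ hw₀
  by_contra hnt
  rw [Metric.tendsto_atTop] at hnt
  push Not at hnt
  obtain ⟨δ, hδ, hfreq⟩ := hnt
  have hfreq' : ∃ᶠ n in atTop, δ ≤ Metric.infDist w₀ (frontier (f n '' D n)) := by
    rw [frequently_atTop]
    intro N
    obtain ⟨n, hn, h⟩ := hfreq N
    refine ⟨n, hn, ?_⟩
    rwa [Real.dist_eq, sub_zero, abs_of_nonneg Metric.infDist_nonneg] at h
  rw [hEo.frontier_eq] at hw₀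
  obtain ⟨w₁, hw₁E, hw₁⟩ := Metric.mem_closure_iff.1 hw₀.1 δ hδ
  have hw₁n : ∀ᶠ n in atTop, w₁ ∈ f n '' D n :=
    (hcpt {w₁} isCompact_singleton (singleton_subset_iff.2 hw₁E)).mono
      fun n hn => hn rfl
  have hballs : ∃ᶠ n in atTop, Metric.ball w₀ δ ⊆ f n '' D n := by
    refine (hfreq'.and_eventually hw₁n).mono ?_
    rintro n ⟨h1, h2⟩
    refine aux_subset_of_frontier (convex_ball _ _).isPreconnected
      (aux_isOpen_image (hDopen n) (hfdiff n) (hfinj n) (hDopen n) Subset.rfl)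
      ⟨w₁, Metric.mem_ball'.2 hw₁, h2⟩ ?_
    rw [Set.disjoint_left]
    intro x hx hxf
    have h3 := Metric.infDist_le_dist_of_mem (x := w₀) hxf
    have h4 := Metric.mem_ball'.1 hx
    linarith
  obtain ⟨φ, hφ, hφb⟩ := extraction_of_frequently_atTop hballs
  have hφt := hφ.tendsto_atTop
  refine hw₀.2 (aux_key (D := fun n => D (φ n)) (f := fun n => f (φ n)) (fun n => hDopen _)
    (fun n => hDconn _) (fun n => hDproper _) hD₀open hD₀c ⟨?_, ?_⟩ (fun n => hfdiff _)
    (fun n => hfinj _) ?_ hnc hw₀.1 hδ hφb)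
  · intro F hF hFD
    exact hφt.eventually (hconv.1 F hF hFD)
  · intro z hz
    exact (hconv.2 z hz).comp hφt
  · intro u hu x hx
    obtain ⟨t, ht, h⟩ := hlu u hu x hx
    exact ⟨t, ht, hφt.eventually h⟩
end
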